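/- Let 𝓛* be a first-order signature containing the polarity signature, let Ω be a set of finitary operation symbols, and let Φ = {φ_f : f ∈ Ω}, where for n-ary f the formula φ_f is an 𝓛*_n-formula with one free variable. Let {P_i : i ∈ I} be 𝓛*-structures based on polarities and U an ultrafilter on I. Assume that for each i ∈ I the stable set lattice P_i⁺ is closed under the operation f^{P_i}_{φ_f} for every f ∈ Ω, and that the stable set lattice (∏_U P_i)⁺ of the ultraproduct is closed under f^{∏_U P_i}_{φ_f} for every f ∈ Ω. Then the map α^U ↦ θ(α^U) is an injective homomorphism of bounded lattices from the ultraproduct ∏_U (P_i⁺) of the stable set lattices into (∏_U P_i)⁺ which moreover commutes with the Ω-operations: for every n-ary f ∈ Ω and all α₀, …, α_{n−1} ∈ ∏_I (P_i⁺), θ(f^{∏_U(P_i⁺)}(α₀^U, …, α_{n−1}^U)) = f^{∏_U P_i}_{φ_f}(θ(α₀^U), …, θ(α_{n−1}^U)), where f^{∏_U(P_i⁺)} is defined coordinatewise on representatives from the operations f^{P_i}_{φ_f}. -/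

import Mathlib

open FirstOrder FirstOrder.Language FirstOrder.Language.Structure

namespace PaperCore

/-! ### Typed polarities and stable set lattices -/

section Pol
variable {X Y : Type*}

def rho (R : X → Y → Prop) (A : Set X) : Set Y := {y | ∀ x ∈ A, R x y}

def lam (R : X → Y → Prop) (B : Set Y) : Set X := {x | ∀ y ∈ B, R x y}

def IsStable (R : X → Y → Prop) (A : Set X) : Prop := lam R (rho R A) ⊆ A

def IsStableY (R : X → Y → Prop) (B : Set Y) : Prop := rho R (lam R B) ⊆ B

lemma rho_anti {R : X → Y → Prop} {A B : Set X} (h : A ⊆ B) : rho R B ⊆ rho R A :=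
  fun y hy x hx => hy x (h hx)

lemma lam_anti {R : X → Y → Prop} {B B' : Set Y} (h : B ⊆ B') : lam R B' ⊆ lam R B :=
  fun x hx y hy => hx y (h hy)

lemma lamrho_mono {R : X → Y → Prop} {A B : Set X} (h : A ⊆ B) :
    lam R (rho R A) ⊆ lam R (rho R B) := lam_anti (rho_anti h)

def Stable (R : X → Y → Prop) : Type _ := {A : Set X // IsStable R A}

namespace Stable

variable {R : X → Y → Prop}

instance : PartialOrder (Stable R) :=
  inferInstanceAs (PartialOrder {A : Set X // IsStable R A})

lemma le_def {A B : Stable R} : A ≤ B ↔ A.1 ⊆ B.1 := Iff.rfl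

instance : InfSet (Stable R) :=
  ⟨fun S => ⟨⋂ A ∈ S, A.1, fun x hx => Set.mem_iInter₂.2 fun A hA =>
    A.2 (lamrho_mono (Set.biInter_subset_of_mem hA) hx)⟩⟩

instance : CompleteLattice (Stable R) :=
  completeLatticeOfInf _ (fun S =>
    ⟨fun A hA => Set.biInter_subset_of_mem hA,
     fun B hB => Set.subset_iInter₂ fun A hA => hB hA⟩)

end Stable
end Pol

/-! ### Ultraproducts of indexed families (as plain quotients) -/

section UProd
variable {I : Type*}

def uSetoid (U : Ultrafilter I) (β : I → Type*) : Setoid (∀ i, β i) where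
  r f g := {i | f i = g i} ∈ U
  iseqv := by
    refine ⟨fun f => ?_, fun {f g} h => ?_, fun {f g h} h1 h2 => ?_⟩
    · exact Filter.univ_mem' (fun i => rfl)
    · exact Filter.mem_of_superset h fun i hi => (hi : f i = g i).symm
    · exact Filter.mem_of_superset (Filter.inter_mem h1 h2) fun i hi =>
        (hi.1 : f i = g i).trans hi.2

def UProd (U : Ultrafilter I) (β : I → Type*) : Type _ := Quotient (uSetoid U β)

def uMk (U : Ultrafilter I) {β : I → Type*} (f : ∀ i, β i) : UProd U β :=
  Quotient.mk (uSetoid U β) f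

lemma uMk_surjective (U : Ultrafilter I) (β : I → Type*) :
    Function.Surjective (uMk U (β := β)) := Quotient.mk''_surjective

/-- `θ(α^U)`: the subset of the ultraproduct determined by a family of subsets. -/
def thetaSet (U : Ultrafilter I) {β : I → Type*} (α : ∀ i, Set (β i)) : Set (UProd U β) :=
  fun m => Quotient.liftOn m (fun f => {i | f i ∈ α i} ∈ U) (by
    intro f g hfg
    refine propext ⟨fun hf => ?_, fun hg => ?_⟩
    · exact Filter.mem_of_superset (Filter.inter_mem hf hfg) fun i hi =>
        show g i ∈ α i from hi.2 ▸ hi.1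
    · exact Filter.mem_of_superset (Filter.inter_mem hg hfg) fun i hi =>
        show f i ∈ α i from hi.2.symm ▸ hi.1)

lemma mem_thetaSet (U : Ultrafilter I) {β : I → Type*} (α : ∀ i, Set (β i)) (f : ∀ i, β i) :
    uMk U f ∈ thetaSet U α ↔ {i | f i ∈ α i} ∈ U := Iff.rfl

end UProd

/-! ### Completions: closed/open elements, density, compactness -/

section Completion
variable {C : Type*} [CompleteLattice C]

def ClosedElt (img : Set C) (c : C) : Prop := ∃ S ⊆ img, c = sInf S

def OpenElt (img : Set C) (c : C) : Prop := ∃ S ⊆ img, c = sSup S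

/-- The completion with image `img` is dense. -/
def DenseCompletion (img : Set C) : Prop :=
  ∀ x : C, (∃ G, (∀ c ∈ G, ClosedElt img c) ∧ x = sSup G) ∧
    (∃ G, (∀ o ∈ G, OpenElt img o) ∧ x = sInf G)

/-- The completion with image `img` is compact. -/
def CompactCompletion (img : Set C) : Prop :=
  ∀ S T : Set C, (∀ c ∈ S, ClosedElt img c) → (∀ o ∈ T, OpenElt img o) →
    sInf S ≤ sSup T →
      ∃ S' T' : Finset C, ↑S' ⊆ S ∧ ↑T' ⊆ T ∧ sInf (S' : Set C) ≤ sSup (T' : Set C)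

def JoinDense (img : Set C) : Prop := ∀ x : C, ∃ G ⊆ img, x = sSup G

def MeetDense (img : Set C) : Prop := ∀ x : C, ∃ G ⊆ img, x = sInf G

/-! Canonical and MacNeille extensions of `n`-ary isotone maps. -/

variable {L : Type*}

def lowerCanExt {n : ℕ} (η : L → C) (g : (Fin n → L) → L) (x : Fin n → C) : C :=
  sSup {z | ∃ p : Fin n → C, (∀ j, ClosedElt (Set.range η) (p j)) ∧ (∀ j, p j ≤ x j) ∧
    z = sInf {w | ∃ a : Fin n → L, (∀ j, p j ≤ η (a j)) ∧ w = η (g a)}}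

def upperCanExt {n : ℕ} (η : L → C) (g : (Fin n → L) → L) (x : Fin n → C) : C :=
  sInf {z | ∃ q : Fin n → C, (∀ j, OpenElt (Set.range η) (q j)) ∧ (∀ j, x j ≤ q j) ∧
    z = sSup {w | ∃ a : Fin n → L, (∀ j, η (a j) ≤ q j) ∧ w = η (g a)}}

def lowerMacExt {n : ℕ} (η : L → C) (g : (Fin n → L) → L) (x : Fin n → C) : C :=
  sSup {w | ∃ a : Fin n → L, (∀ j, η (a j) ≤ x j) ∧ w = η (g a)}

def upperMacExt {n : ℕ} (η : L → C) (g : (Fin n → L) → L) (x : Fin n → C) : C :=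
  sInf {w | ∃ a : Fin n → L, (∀ j, x j ≤ η (a j)) ∧ w = η (g a)}

/-- `F` preserves arbitrary joins (including the empty join) in each coordinate. -/
def CompleteNormalOp {n : ℕ} (F : (Fin n → C) → C) : Prop :=
  ∀ (as : Fin n → C) (j : Fin n) (G : Set C),
    F (Function.update as j (sSup G)) = ⨆ B ∈ G, F (Function.update as j B)

/-- `F` preserves arbitrary meets (including the empty meet) in each coordinate. -/
def CompleteNormalDualOp {n : ℕ} (F : (Fin n → C) → C) : Prop :=
  ∀ (as : Fin n → C) (j : Fin n) (G : Set C),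
    F (Function.update as j (sInf G)) = ⨅ B ∈ G, F (Function.update as j B)

end Completion

/-! ### First-order polarity-based structures and definable operations -/

section FO

/-- The language with `n` fresh unary relation symbols `S₀, …, S_{n-1}`. -/
def unaryLang (n : ℕ) : FirstOrder.Language where
  Functions := fun _ => Empty
  Relations := fun k => match k with
    | 1 => Fin n
    | _ => Empty

/-- The structure interpreting each `Sₘ` as `A m`. -/
def unaryStructure {M : Type*} {n : ℕ} (A : Fin n → Set M) : (unaryLang n).Structure M where
  funMap := fun {k} f _ => f.elim
  RelMap := fun {k} => match k with
    | 0 => fun r _ => r.elim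
    | 1 => fun r v => v 0 ∈ A r
    | (_ + 2) => fun r _ => r.elim

/-- The expansion `⟨P, A₀, …, A_{n-1}⟩` of a structure by `n` set parameters. -/
def withParams {L : FirstOrder.Language} {M : Type*} [L.Structure M] {n : ℕ}
    (A : Fin n → Set M) : (L.sum (unaryLang n)).Structure M :=
  letI := unaryStructure A
  inferInstance

variable {L : FirstOrder.Language} {M : Type*} [L.Structure M]

def pX (Xb : L.Relations 1) (M : Type*) [L.Structure M] : Set M := {m | RelMap Xb ![m]}

def pR (Rb : L.Relations 2) : M → M → Prop := fun a b => RelMap Rb ![a, b]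

/-- The operation on subsets of `X` defined by a formula `φ(v)` of `𝓛*_n`:
`f^P_φ(A₀,…,A_{n-1}) = {x ∈ X : ⟨P, A⟩ ⊨ φ[x]}`. -/
def defOp (Xb : L.Relations 1) {n : ℕ}
    (φ : (L.sum (unaryLang n)).Formula (Fin 1)) (A : Fin n → Set M) : Set M :=
  {x | x ∈ pX Xb M ∧ @Formula.Realize _ M (withParams A) _ φ (fun _ => x)}

/-- Set-based polarity data inside a one-sorted universe. -/
def rhoS (Yset : Set M) (R : M → M → Prop) (A : Set M) : Set M :=
  {y | y ∈ Yset ∧ ∀ x ∈ A, R x y}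

def lamS (Xset : Set M) (R : M → M → Prop) (B : Set M) : Set M :=
  {x | x ∈ Xset ∧ ∀ y ∈ B, R x y}

def IsStableS (Xset Yset : Set M) (R : M → M → Prop) (A : Set M) : Prop :=
  A ⊆ Xset ∧ lamS Xset R (rhoS Yset R A) ⊆ A

def StableS (Xset Yset : Set M) (R : M → M → Prop) : Type _ :=
  {A : Set M // IsStableS Xset Yset R A}

namespace StableS

variable {Xset Yset : Set M} {R : M → M → Prop}

lemma lamS_subset (B : Set M) : lamS Xset R B ⊆ Xset := fun _ hx => hx.1

lemma rhoS_anti {A B : Set M} (h : A ⊆ B) : rhoS Yset R B ⊆ rhoS Yset R A :=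
  fun y hy => ⟨hy.1, fun x hx => hy.2 x (h hx)⟩

lemma lamS_anti {B B' : Set M} (h : B ⊆ B') : lamS Xset R B' ⊆ lamS Xset R B :=
  fun x hx => ⟨hx.1, fun y hy => hx.2 y (h hy)⟩

lemma lamrhoS_mono {A B : Set M} (h : A ⊆ B) :
    lamS Xset R (rhoS Yset R A) ⊆ lamS Xset R (rhoS Yset R B) :=
  lamS_anti (rhoS_anti (Yset := Yset) h)

instance : PartialOrder (StableS Xset Yset R) :=
  inferInstanceAs (PartialOrder {A : Set M // IsStableS Xset Yset R A})

lemma le_def {A B : StableS Xset Yset R} : A ≤ B ↔ A.1 ⊆ B.1 := Iff.rfl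

instance : InfSet (StableS Xset Yset R) :=
  ⟨fun S => ⟨Xset ∩ ⋂ A ∈ S, A.1,
    ⟨Set.inter_subset_left, fun x hx =>
      ⟨(lamS_subset _) hx, Set.mem_iInter₂.2 fun A hA =>
        A.2.2 (lamrhoS_mono (Set.inter_subset_right.trans (Set.biInter_subset_of_mem hA)) hx)⟩⟩⟩⟩

instance : CompleteLattice (StableS Xset Yset R) :=
  completeLatticeOfInf _ (fun S =>
    ⟨fun A hA => (Set.inter_subset_right.trans (Set.biInter_subset_of_mem hA) :
        Xset ∩ ⋂ A ∈ S, A.1 ⊆ A.1),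
     fun B hB => Set.subset_inter B.2.1 (Set.subset_iInter₂ fun A hA => hB hA)⟩)

end StableS

end FO

end PaperCore

namespace PaperCore
section FO2
variable {I : Type*}

/-- `f^U`: the element of the ultraproduct determined by `f ∈ ∏_I M_i`. -/
def pmk (U : Ultrafilter I) {M : I → Type*} (f : ∀ i, M i) : (U : Filter I).Product M :=
  Quotient.mk (Filter.productSetoid (U : Filter I) M) f

/-- `θ(α^U) = {f^U ∈ ∏_U M_i : {i : f(i) ∈ α(i)} ∈ U}`. -/
def thetaSetP (U : Ultrafilter I) {M : I → Type*} (α : ∀ i, Set (M i)) :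
    Set ((U : Filter I).Product M) :=
  fun m => Quotient.liftOn (s := Filter.productSetoid (U : Filter I) M) m
    (fun f => {i | f i ∈ α i} ∈ U) (by
      intro f g hfg
      have hfg' : {i | f i = g i} ∈ U := hfg
      refine propext ⟨fun hf => ?_, fun hg => ?_⟩
      · exact Filter.mem_of_superset (Filter.inter_mem hf hfg') fun i hi =>
          show g i ∈ α i from hi.2 ▸ hi.1
      · exact Filter.mem_of_superset (Filter.inter_mem hg hfg') fun i hi =>
          show f i ∈ α i from hi.2.symm ▸ hi.1)

lemma mem_thetaSetP (U : Ultrafilter I) {M : I → Type*} (α : ∀ i, Set (M i)) (f : ∀ i, M i) :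
    pmk U f ∈ thetaSetP U α ↔ {i | f i ∈ α i} ∈ U := Iff.rfl

/-- The ultrapower `P^U` of a single universe `M`. -/
abbrev UPow (U : Ultrafilter I) (M : Type*) : Type _ := (U : Filter I).Product (fun _ : I => M)

/-- The stable set lattice `P⁺` of a polarity-based `𝓛*`-structure `M`. -/
abbrev StabFO {L : FirstOrder.Language} (Xb Yb : L.Relations 1) (Rb : L.Relations 2)
    (M : Type*) [L.Structure M] : Type _ :=
  StableS (pX Xb M) (pX Yb M) (pR (M := M) Rb)

end FO2
end PaperCore

namespace PaperCore

section StableOrder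
variable {M : Type*} {X Y : Set M} {R : M → M → Prop}

lemma subset_lamS_rhoS {A : Set M} (hA : A ⊆ X) : A ⊆ lamS X R (rhoS Y R A) :=
  fun x hx => ⟨hA hx, fun _ hy => hy.2 x hx⟩

lemma isStableS_lamS {B : Set M} (hB : B ⊆ Y) : IsStableS X Y R (lamS X R B) :=
  ⟨StableS.lamS_subset B, StableS.lamS_anti fun y hy => ⟨hB hy, fun _ hx => hx.2 y hy⟩⟩

namespace StableS

lemma inf_val (A B : StableS X Y R) : (A ⊓ B).1 = A.1 ∩ B.1 := by
  refine (Set.subset_inter (le_def.1 inf_le_left) (le_def.1 inf_le_right)).antisymm ?_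
  have hst : IsStableS X Y R (A.1 ∩ B.1) :=
    ⟨Set.inter_subset_left.trans A.2.1, Set.subset_inter
      ((lamrhoS_mono Set.inter_subset_left).trans A.2.2)
      ((lamrhoS_mono Set.inter_subset_right).trans B.2.2)⟩
  let C : StableS X Y R := ⟨_, hst⟩
  have h : C ≤ A ⊓ B :=
    le_inf (le_def (B := A).2 Set.inter_subset_left) (le_def (B := B).2 Set.inter_subset_right)
  exact le_def.1 h

lemma sup_val (A B : StableS X Y R) : (A ⊔ B).1 = lamS X R (rhoS Y R (A.1 ∪ B.1)) := by
  refine Set.Subset.antisymm ?_ ?_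
  · have hsub : A.1 ∪ B.1 ⊆ lamS X R (rhoS Y R (A.1 ∪ B.1)) :=
      subset_lamS_rhoS (Set.union_subset A.2.1 B.2.1)
    have h : A ⊔ B ≤ ⟨lamS X R (rhoS Y R (A.1 ∪ B.1)), isStableS_lamS fun _ hy => hy.1⟩ :=
      sup_le (le_def.2 (Set.subset_union_left.trans hsub))
        (le_def.2 (Set.subset_union_right.trans hsub))
    exact le_def.1 h
  · exact (lamrhoS_mono (Set.union_subset (le_def.1 le_sup_left) (le_def.1 le_sup_right))).trans
      (A ⊔ B).2.2

lemma top_val : (⊤ : StableS X Y R).1 = X := by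
  let C : StableS X Y R := ⟨X, subset_rfl, lamS_subset _⟩
  have h : C ≤ ⊤ := le_top
  exact (⊤ : StableS X Y R).2.1.antisymm (le_def.1 h)

lemma bot_val : (⊥ : StableS X Y R).1 = lamS X R (rhoS Y R ∅) := by
  have h : (⊥ : StableS X Y R) ≤ ⟨lamS X R (rhoS Y R ∅), isStableS_lamS fun _ hy => hy.1⟩ :=
    bot_le
  exact Set.Subset.antisymm (le_def.1 h)
    ((lamrhoS_mono (Set.empty_subset _)).trans (⊥ : StableS X Y R).2.2)

end StableS
end StableOrder

section Theta
variable {I : Type*} {U : Ultrafilter I} {M : I → Type*}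

lemma pmk_surjective : Function.Surjective (pmk U (M := M)) := Quotient.mk''_surjective

lemma pmk_mem_thetaSetP {α : ∀ i, Set (M i)} {f : ∀ i, M i} :
    pmk U f ∈ thetaSetP U α ↔ ∀ᶠ i in (U : Filter I), f i ∈ α i := Iff.rfl

lemma thetaSetP_inter (α β : ∀ i, Set (M i)) :
    thetaSetP U (fun i => α i ∩ β i) = thetaSetP U α ∩ thetaSetP U β := by
  ext m
  obtain ⟨f, rfl⟩ := pmk_surjective m
  exact Filter.eventually_and

lemma thetaSetP_union (α β : ∀ i, Set (M i)) :
    thetaSetP U (fun i => α i ∪ β i) = thetaSetP U α ∪ thetaSetP U β := by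
  ext m
  obtain ⟨f, rfl⟩ := pmk_surjective m
  exact Ultrafilter.eventually_or

lemma thetaSetP_empty : thetaSetP U (fun i => (∅ : Set (M i))) = ∅ := by
  ext m
  obtain ⟨f, rfl⟩ := pmk_surjective m
  simp [pmk_mem_thetaSetP, U.neBot.ne]

lemma thetaSetP_congr {α β : ∀ i, Set (M i)} (h : ∀ᶠ i in (U : Filter I), α i = β i) :
    thetaSetP U α = thetaSetP U β := by
  ext m
  obtain ⟨f, rfl⟩ := pmk_surjective m
  exact Filter.eventually_congr (h.mono fun i hi => by rw [hi])

variable [∀ i, Nonempty (M i)]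

/-- Quantification over `θ(α^U)` is coordinatewise: counterexamples chosen in each coordinate form
an element of the ultraproduct. -/
lemma forall_thetaSetP_iff {α : ∀ i, Set (M i)} {p : ∀ i, M i → Prop} :
    (∀ f : ∀ i, M i, pmk U f ∈ thetaSetP U α → ∀ᶠ i in (U : Filter I), p i (f i)) ↔
      ∀ᶠ i in (U : Filter I), ∀ x ∈ α i, p i x := by
  constructor
  · intro h
    by_contra hc
    have hc' := Ultrafilter.eventually_not.2 hc
    let g : ∀ i, M i := fun i => Classical.epsilon fun x => x ∈ α i ∧ ¬ p i x
    have hg : ∀ᶠ i in (U : Filter I), g i ∈ α i ∧ ¬ p i (g i) :=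
      hc'.mono fun i hi => Classical.epsilon_spec (p := fun x => x ∈ α i ∧ ¬ p i x) (by
        push Not at hi
        exact hi)
    exact Ultrafilter.eventually_not.1 (hg.mono fun i hi => hi.2) (h g (hg.mono fun i hi => hi.1))
  · intro h f hf
    filter_upwards [h, pmk_mem_thetaSetP.1 hf] with i hi hfi using hi _ hfi

lemma thetaSetP_subset_iff {α β : ∀ i, Set (M i)} :
    thetaSetP U α ⊆ thetaSetP U β ↔ ∀ᶠ i in (U : Filter I), α i ⊆ β i := by
  refine Iff.trans ⟨fun h f hf => h hf, fun h m hm => ?_⟩ forall_thetaSetP_iff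
  obtain ⟨f, rfl⟩ := pmk_surjective m
  exact h f hm

lemma thetaSetP_injective {α β : ∀ i, Set (M i)} (h : thetaSetP U α = thetaSetP U β) :
    ∀ᶠ i in (U : Filter I), α i = β i := by
  filter_upwards [thetaSetP_subset_iff.1 h.subset, thetaSetP_subset_iff.1 h.superset]
    with i h1 h2 using h1.antisymm h2

variable {R : ∀ i, M i → M i → Prop}
  {RU : (U : Filter I).Product M → (U : Filter I).Product M → Prop}

lemma rhoS_thetaSetP (hR : ∀ f g, RU (pmk U f) (pmk U g) ↔ ∀ᶠ i in (U : Filter I), R i (f i) (g i))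
    (Y α : ∀ i, Set (M i)) :
    rhoS (thetaSetP U Y) RU (thetaSetP U α) = thetaSetP U (fun i => rhoS (Y i) (R i) (α i)) := by
  ext m
  obtain ⟨g, rfl⟩ := pmk_surjective m
  refine Iff.trans (and_congr Iff.rfl ?_) Filter.eventually_and.symm
  refine Iff.trans ?_ (forall_thetaSetP_iff (p := fun i x => R i x (g i)))
  simp only [pmk_surjective.forall, hR]

lemma lamS_thetaSetP (hR : ∀ f g, RU (pmk U f) (pmk U g) ↔ ∀ᶠ i in (U : Filter I), R i (f i) (g i))
    (X β : ∀ i, Set (M i)) :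
    lamS (thetaSetP U X) RU (thetaSetP U β) = thetaSetP U (fun i => lamS (X i) (R i) (β i)) := by
  ext m
  obtain ⟨g, rfl⟩ := pmk_surjective m
  refine Iff.trans (and_congr Iff.rfl ?_) Filter.eventually_and.symm
  refine Iff.trans ?_ (forall_thetaSetP_iff (p := fun i y => R i (g i) y))
  simp only [pmk_surjective.forall, hR]

end Theta

section Ultraproduct
variable {L : FirstOrder.Language} {I : Type*} {U : Ultrafilter I} {M : I → Type*}
  [∀ i, L.Structure (M i)]

lemma relMap_pmk {n : ℕ} (r : L.Relations n) (x : Fin n → ∀ i, M i) :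
    (RelMap r fun j => pmk U (x j)) ↔ ∀ᶠ i in (U : Filter I), RelMap r fun j => x j i :=
  relMap_quotient_mk' (s := (U : Filter I).productSetoid M) r x

lemma pX_product (Xb : L.Relations 1) :
    pX Xb ((U : Filter I).Product M) = thetaSetP U (fun i => pX Xb (M i)) := by
  ext m
  obtain ⟨f, rfl⟩ := pmk_surjective m
  have h := relMap_pmk (U := U) Xb ![f]
  have h1 : (fun j => pmk U (![f] j)) = ![pmk U f] := by
    ext j; fin_cases j; rfl
  have h2 (i : I) : (fun j => ![f] j i) = ![f i] := by
    ext j; fin_cases j; rfl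
  simp only [h1, h2] at h
  exact h

lemma pR_pmk (Rb : L.Relations 2) (f g : ∀ i, M i) :
    pR Rb (pmk U f) (pmk U g) ↔ ∀ᶠ i in (U : Filter I), pR Rb (f i) (g i) := by
  have h := relMap_pmk (U := U) Rb ![f, g]
  have h1 : (fun j => pmk U (![f, g] j)) = ![pmk U f, pmk U g] := by
    ext j; fin_cases j <;> rfl
  have h2 (i : I) : (fun j => ![f, g] j i) = ![f i, g i] := by
    ext j; fin_cases j <;> rfl
  simp only [h1, h2] at h
  exact h

/-- Expanding by set parameters commutes with the formation of ultraproducts. -/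
lemma withParams_product {n : ℕ} (A : Fin n → ∀ i, Set (M i)) :
    withParams (L := L) (fun j => thetaSetP U (A j)) =
      @Ultraproduct.structure I M U _ (fun i => withParams fun j => A j i) := by
  have hrep {k : ℕ} (x : Fin k → (U : Filter I).Product M) :
      ∃ y : Fin k → ∀ i, M i, x = fun j => pmk U (y j) := by
    choose y hy using fun j => pmk_surjective (x j)
    exact ⟨y, funext fun j => (hy j).symm⟩
  refine FirstOrder.Language.Structure.ext ?_ ?_
  · ext k f x
    obtain ⟨y, rfl⟩ := hrep x
    let _ : ∀ i, (L.sum (unaryLang n)).Structure (M i) := fun i => withParams fun j => A j i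
    refine Eq.trans ?_ (Ultraproduct.funMap_cast (u := U) f y).symm
    rcases f with f | f
    · exact Ultraproduct.funMap_cast (u := U) f y
    · exact Empty.elim f
  · ext k r x
    obtain ⟨y, rfl⟩ := hrep x
    let _ : ∀ i, (L.sum (unaryLang n)).Structure (M i) := fun i => withParams fun j => A j i
    refine Iff.trans ?_ (relMap_pmk (U := U) r y).symm
    rcases r with r | r
    · exact relMap_pmk (U := U) r y
    · match k, r with
      | 0, r => exact Empty.elim r
      | 1, r => exact Iff.rfl
      | _ + 2, r => exact Empty.elim r

variable [∀ i, Nonempty (M i)]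

lemma defOp_thetaSetP (Xb : L.Relations 1) {n : ℕ}
    (φ : (L.sum (unaryLang n)).Formula (Fin 1)) (A : Fin n → ∀ i, Set (M i)) :
    defOp Xb φ (fun j => thetaSetP U (A j)) =
      thetaSetP U (fun i => defOp Xb φ fun j => A j i) := by
  ext m
  obtain ⟨f, rfl⟩ := pmk_surjective m
  refine Iff.trans (and_congr ?_ ?_) Filter.eventually_and.symm
  · rw [pX_product]; rfl
  · rw [withParams_product]
    let _ : ∀ i, (L.sum (unaryLang n)).Structure (M i) := fun i => withParams fun j => A j i
    exact Ultraproduct.realize_formula_cast φ fun _ => f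

/-- A family of stable sets determines a stable set of the ultraproduct. -/
lemma isStableS_thetaSetP (Xb Yb : L.Relations 1) (Rb : L.Relations 2)
    (α : ∀ i, StabFO Xb Yb Rb (M i)) :
    IsStableS (pX Xb ((U : Filter I).Product M)) (pX Yb ((U : Filter I).Product M)) (pR Rb)
      (thetaSetP U fun i => (α i).1) := by
  rw [pX_product, pX_product]
  refine ⟨thetaSetP_subset_iff.2 (.of_forall fun i => (α i).2.1), ?_⟩
  rw [rhoS_thetaSetP (pR_pmk Rb), lamS_thetaSetP (pR_pmk Rb)]
  exact thetaSetP_subset_iff.2 (.of_forall fun i => (α i).2.2)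

/-- The embedding `α^U ↦ θ(α^U)`. -/
def thetaStable (Xb Yb : L.Relations 1) (Rb : L.Relations 2)
    (a : UProd U fun i => StabFO Xb Yb Rb (M i)) : StabFO Xb Yb Rb ((U : Filter I).Product M) :=
  Quotient.liftOn a (fun α => ⟨_, isStableS_thetaSetP Xb Yb Rb α⟩) fun _ _ h =>
    Subtype.ext (thetaSetP_congr (Filter.Eventually.mono h fun _ hi => congrArg Subtype.val hi))

lemma lamS_rhoS_thetaSetP (Xb Yb : L.Relations 1) (Rb : L.Relations 2) (α : ∀ i, Set (M i)) :
    lamS (pX Xb ((U : Filter I).Product M)) (pR Rb)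
        (rhoS (pX Yb ((U : Filter I).Product M)) (pR Rb) (thetaSetP U α)) =
      thetaSetP U fun i => lamS (pX Xb (M i)) (pR Rb) (rhoS (pX Yb (M i)) (pR Rb) (α i)) := by
  rw [pX_product, pX_product, rhoS_thetaSetP (pR_pmk Rb), lamS_thetaSetP (pR_pmk Rb)]

end Ultraproduct
end PaperCore

open PaperCore in
/-- Theorem 4.1 of the paper: `θ` is an injective bounded-lattice
homomorphism from the ultraproduct of the stable set lattices into the stable set lattice
of the ultraproduct structure, commuting with all the operations defined by the formulas
`φ_f` (the operations on the ultraproduct of lattices being coordinatewise on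
representatives). -/
theorem statement1 {L : FirstOrder.Language} (Xb Yb : L.Relations 1) (Rb : L.Relations 2)
    {I : Type*} (U : Ultrafilter I) (M : I → Type*) [∀ i, L.Structure (M i)]
    [∀ i, Nonempty (M i)]
    (hcover : ∀ (i : I) (m : M i), RelMap Xb ![m] ∨ RelMap Yb ![m])
    (htype : ∀ (i : I) (a b : M i), RelMap Rb ![a, b] → RelMap Xb ![a] ∧ RelMap Yb ![b])
    {Ω : Type*} (ar : Ω → ℕ)
    (Φf : ∀ f : Ω, (L.sum (unaryLang (ar f))).Formula (Fin 1))
    (hclos : ∀ (i : I) (f : Ω) (As : Fin (ar f) → StabFO Xb Yb Rb (M i)),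
      IsStableS (pX Xb (M i)) (pX Yb (M i)) (pR Rb)
        (defOp Xb (Φf f) fun j => (As j).1))
    (hclosU : ∀ (f : Ω) (As : Fin (ar f) → StabFO Xb Yb Rb ((U : Filter I).Product M)),
      IsStableS (pX Xb ((U : Filter I).Product M)) (pX Yb ((U : Filter I).Product M))
        (pR Rb) (defOp Xb (Φf f) fun j => (As j).1)) :
    ∃ θ : UProd U (fun i => StabFO Xb Yb Rb (M i)) →
        StabFO Xb Yb Rb ((U : Filter I).Product M),
      (∀ α : ∀ i, StabFO Xb Yb Rb (M i),
        (θ (uMk U α)).1 = thetaSetP U (fun i => (α i).1)) ∧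
      Function.Injective θ ∧
      (∀ α β : ∀ i, StabFO Xb Yb Rb (M i),
        θ (uMk U (fun i => α i ⊓ β i)) = θ (uMk U α) ⊓ θ (uMk U β)) ∧
      (∀ α β : ∀ i, StabFO Xb Yb Rb (M i),
        θ (uMk U (fun i => α i ⊔ β i)) = θ (uMk U α) ⊔ θ (uMk U β)) ∧
      θ (uMk U (fun i => (⊤ : StabFO Xb Yb Rb (M i)))) = ⊤ ∧
      θ (uMk U (fun i => (⊥ : StabFO Xb Yb Rb (M i)))) = ⊥ ∧
      (∀ (f : Ω) (αs : Fin (ar f) → ∀ i, StabFO Xb Yb Rb (M i)),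
        θ (uMk U (fun i => (⟨defOp Xb (Φf f) fun j => (αs j i).1,
            hclos i f (fun j => αs j i)⟩ : StabFO Xb Yb Rb (M i)))) =
          ⟨defOp Xb (Φf f) fun j => (θ (uMk U (αs j))).1,
            hclosU f (fun j => θ (uMk U (αs j)))⟩) := by
  refine ⟨thetaStable Xb Yb Rb, fun α => rfl, ?_, fun α β => Subtype.ext ?_,
    fun α β => Subtype.ext ?_, Subtype.ext ?_, Subtype.ext ?_, fun f αs => Subtype.ext ?_⟩
  · intro a b h
    obtain ⟨α, rfl⟩ := uMk_surjective U _ a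
    obtain ⟨β, rfl⟩ := uMk_surjective U _ b
    exact Quotient.sound ((thetaSetP_injective (congrArg Subtype.val h)).mono
      fun i hi => Subtype.ext hi)
  · rw [StableS.inf_val]
    refine Eq.trans ?_ (thetaSetP_inter _ _)
    exact congrArg (thetaSetP U) (funext fun i => StableS.inf_val _ _)
  · rw [StableS.sup_val]
    refine (congrArg (thetaSetP U) (funext fun i => StableS.sup_val _ _)).trans ?_
    rw [← lamS_rhoS_thetaSetP, thetaSetP_union]
    rfl
  · refine (congrArg (thetaSetP U) (funext fun i => StableS.top_val)).trans ?_
    exact (pX_product Xb).symm.trans StableS.top_val.symm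
  · rw [StableS.bot_val]
    refine (congrArg (thetaSetP U) (funext fun i => StableS.bot_val)).trans ?_
    rw [← lamS_rhoS_thetaSetP, thetaSetP_empty]
  · exact (defOp_thetaSetP Xb (Φf f) fun j i => (αs j i).1).symm
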